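/- Let V be a type, let G be a simple graph on V that is acyclic (contains no cycles), and let w : V → V → ℤ be a weight function that is antisymmetric on edges, i.e., w x y = - (w y x) whenever x and y are adjacent in G. Then there exists a function f : V → ℤ such that for every pair of adjacent vertices x, y of G one has f y = f x + w x y. -/

import Mathlib

/-- Total weight of a walk. -/
def walkWeight {V : Type*} {G : SimpleGraph V} (w : V → V → ℤ) {u v : V} (p : G.Walk u v) : ℤ :=
  (p.darts.map fun d => w d.fst d.snd).sum

/-- If `G` is an acyclic simple graph and `w` is an integer weight function that is
antisymmetric on edges, then there exists an integer-valued function `f` (a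
"stratification") such that `f y = f x + w x y` across every edge. -/
theorem acyclic_stratification {V : Type*} (G : SimpleGraph V) (hG : G.IsAcyclic)
    (w : V → V → ℤ) (hw : ∀ x y, G.Adj x y → w x y = - w y x) :
    ∃ f : V → ℤ, ∀ x y, G.Adj x y → f y = f x + w x y := by
  classical
  have hr : ∀ v, G.Reachable v (G.connectedComponentMk v).out := fun v =>
    SimpleGraph.ConnectedComponent.exact (Quot.out_eq (G.connectedComponentMk v)).symm
  choose P hP using fun v => (hr v).exists_isPath
  have key : ∀ (x y r : V) (h : G.Adj x y) (p : G.Walk x r) (q : G.Walk y r), p.IsPath →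
      q.IsPath → x ∉ q.support → walkWeight w p = w x y + walkWeight w q := by
    intro x y r h p q hp hq hx
    have hc : (SimpleGraph.Walk.cons h q).IsPath := hq.cons hx
    have := congrArg Subtype.val (hG.path_unique ⟨p, hp⟩ ⟨_, hc⟩)
    simp only at this
    subst this
    simp [walkWeight]
  have key2 : ∀ (x y r s : V) (h : G.Adj x y) (p : G.Walk x r) (q : G.Walk y s), r = s →
      p.IsPath → q.IsPath → walkWeight w p = w x y + walkWeight w q := by
    intro x y r s h p q hrs hp hq
    subst hrs
    by_cases hx : x ∈ q.support
    · have hy : y ∉ p.support := by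
        intro hy
        have := hG.ne_mem_support_of_support_of_adj_of_isPath hp.reverse hq.reverse h
          (by simpa using hy)
        simp_all
      rw [key y x r h.symm q p hq hp hy, hw x y h]
      ring
    · exact key x y r h p q hp hq hx
  refine ⟨fun v => - walkWeight w (P v), fun x y h => ?_⟩
  have := key2 x y _ _ h (P x) (P y)
    (by rw [SimpleGraph.ConnectedComponent.sound h.reachable]) (hP x) (hP y)
  simp only
  linarith
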